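/- arXiv:2502.18419 — 4 statements merged into one kernel-verified Lean document; each statement's English description precedes it below -/
import Mathlib

section
/- Let 1 ≤ m ≤ n be integers, let ℐ be a finite index set, and for each α ∈ ℐ let I_α, J_α ⊆ {1,…,m+n} be m-element subsets and c_α ∈ ℝ. Then ∑_{α∈ℐ} c_α Δ_{I_α}(Ā) Δ_{J_α}(Ā) ≥ 0 for every n×m totally nonnegative real matrix A (where Ā is the (m+n)×m matrix stacking A on top of W_0) if and only if ∑_{α∈ℐ} c_α Δ_{I_α}(ℬ) Δ_{J_α}(ℬ) ≥ 0 for every full-rank (m+n)×m real matrix ℬ all of whose Plücker coordinates are nonnegative. -/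
open Finset

/-- The Plücker coordinate `Δ_I(A)`: the determinant of the `m × m` submatrix of `A`
whose rows are indexed by `I` in increasing order (and all `m` columns);
junk value `0` when `I` does not have `m` elements. -/
noncomputable def pluck {N m : ℕ} (A : Matrix (Fin N) (Fin m) ℝ) (I : Finset (Fin N)) : ℝ :=
  if h : I.card = m then (A.submatrix (fun k => ((I.orderIsoOfFin h) k : Fin N)) id).det else 0

/-- The minor `det A_{I,J}` of `A` with rows `I` and columns `J` taken in increasing order;
junk value `0` when `|I| ≠ |J|` (and `det A_{∅,∅} = 1`). -/
noncomputable def minor {p q : ℕ} (A : Matrix (Fin p) (Fin q) ℝ)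
    (I : Finset (Fin p)) (J : Finset (Fin q)) : ℝ :=
  if h : J.card = I.card then
    (A.submatrix (fun a : Fin I.card => ((I.orderIsoOfFin rfl) a : Fin p))
      (fun b : Fin I.card => ((J.orderIsoOfFin h) b : Fin q))).det
  else 0

/-- A real matrix is totally nonnegative: every (square) minor is nonnegative. -/
def TNN {p q : ℕ} (A : Matrix (Fin p) (Fin q) ℝ) : Prop :=
  ∀ (I : Finset (Fin p)) (J : Finset (Fin q)), 0 ≤ minor A I J

/-- The `m × m` matrix `W₀` with `(W₀)_{i,j} = (-1)^{i+1}` if `j = m - i + 1` and `0`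
otherwise (1-indexed); 0-indexed: entry `(-1)^i` at `j = m - 1 - i`. -/
def W0 (m : ℕ) : Matrix (Fin m) (Fin m) ℝ :=
  fun i j => if (j : ℕ) = m - 1 - (i : ℕ) then (-1 : ℝ) ^ (i : ℕ) else 0

/-- The `(m+n) × m` matrix obtained by stacking the `n × m` matrix `A` on top of the
`m × m` matrix `B`. -/
def stack {m n : ℕ} (A : Matrix (Fin n) (Fin m) ℝ) (B : Matrix (Fin m) (Fin m) ℝ) :
    Matrix (Fin (m + n)) (Fin m) ℝ :=
  fun i j =>
    if h : (i : ℕ) < n then A ⟨(i : ℕ), h⟩ j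
    else B ⟨(i : ℕ) - n, by have := i.isLt; omega⟩ j

/-- All Plücker coordinates are nonnegative, with row sets given by increasing maps. -/
def PluckNonneg {N m : ℕ} (B : Matrix (Fin N) (Fin m) ℝ) : Prop :=
  ∀ f : Fin m → Fin N, StrictMono f → 0 ≤ (B.submatrix f id).det

lemma StrictMono.orderIsoOfFin_image {k N : ℕ} {f : Fin k → Fin N} (hf : StrictMono f)
    {s : Finset (Fin N)} (hs : s = univ.image f) (h : s.card = k) :
    (fun i => ((s.orderIsoOfFin h) i : Fin N)) = f := by
  refine (orderEmbOfFin_unique h (fun x => ?_) hf).symm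
  simp [hs]

lemma pluckNonneg_iff {N m : ℕ} (B : Matrix (Fin N) (Fin m) ℝ) :
    PluckNonneg B ↔ ∀ K, 0 ≤ pluck B K := by
  constructor
  · intro h K
    unfold pluck
    split_ifs with hK
    · exact h _ (K.orderEmbOfFin hK).strictMono
    · exact le_rfl
  · intro h f hf
    have hc : (univ.image f).card = m := by
      rw [card_image_of_injective _ hf.injective, card_univ, Fintype.card_fin]
    have := h (univ.image f)
    rwa [pluck, dif_pos hc, hf.orderIsoOfFin_image rfl hc] at this

lemma tnn_iff {p q : ℕ} (A : Matrix (Fin p) (Fin q) ℝ) :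
    TNN A ↔ ∀ (k : ℕ) (r : Fin k → Fin p) (g : Fin k → Fin q), StrictMono r → StrictMono g →
      0 ≤ (A.submatrix r g).det := by
  constructor
  · intro h k r g hr hg
    have hI : (univ.image r).card = k := by
      rw [card_image_of_injective _ hr.injective, card_univ, Fintype.card_fin]
    have hJ : (univ.image g).card = k := by
      rw [card_image_of_injective _ hg.injective, card_univ, Fintype.card_fin]
    obtain ⟨s, hs⟩ : ∃ s, s = univ.image r := ⟨_, rfl⟩
    obtain ⟨u, hu⟩ : ∃ u, u = univ.image g := ⟨_, rfl⟩
    have := h s u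
    rw [← hs] at hI
    rw [← hu] at hJ
    subst hI
    rwa [minor, dif_pos hJ, hr.orderIsoOfFin_image hs, hg.orderIsoOfFin_image hu] at this
  · intro h I J
    unfold minor
    split_ifs with hJ
    · exact h _ _ _ (I.orderEmbOfFin rfl).strictMono (J.orderEmbOfFin hJ).strictMono
    · exact le_rfl

lemma TNN.submatrix {p q p' q' : ℕ} {A : Matrix (Fin p) (Fin q) ℝ} (hA : TNN A)
    {r : Fin p' → Fin p} {g : Fin q' → Fin q} (hr : StrictMono r) (hg : StrictMono g) :
    TNN (A.submatrix r g) := by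
  rw [tnn_iff] at hA ⊢
  intro k r' g' hr' hg'
  exact hA k (r ∘ r') (g ∘ g') (hr.comp hr') (hg.comp hg')

/-- Laplace expansion along a last row coming from `W₀`. -/
lemma det_stack_snoc {m n : ℕ} (A : Matrix (Fin n) (Fin (m + 1)) ℝ) (q : Fin (m + 1))
    (f : Fin m → Fin (m + n)) (F : Fin (m + 1) → Fin (m + 1 + n))
    (hF : ∀ i : Fin m, (F i.castSucc : ℕ) = f i) (hlast : (F (Fin.last m) : ℕ) = n + q)
    (hf : ∀ i, (f i : ℕ) < n + q) :
    ((stack A (W0 (m + 1))).submatrix F id).det =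
      ((stack (A.submatrix id q.rev.succAbove) (W0 m)).submatrix f id).det := by
  have hrow : ∀ j, stack A (W0 (m + 1)) (F (Fin.last m)) j =
      if j = q.rev then (-1 : ℝ) ^ (q : ℕ) else 0 := by
    intro j
    have hq : n + (q : ℕ) - n = q := by omega
    simp only [stack, hlast, W0, hq, Fin.ext_iff, Fin.val_rev]
    rw [dif_neg (by omega)]
    congr 1
    apply propext
    omega
  rw [Matrix.det_succ_row _ (Fin.last m), Finset.sum_eq_single q.rev]
  · rw [Matrix.submatrix_apply, id, hrow, if_pos rfl, ← pow_add, Even.neg_one_pow, one_mul]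
    · congr 1
      ext i j
      have hi := hf i
      simp only [Matrix.submatrix_apply, id, stack, Fin.succAbove_last, hF]
      split_ifs with h
      · rfl
      · simp only [W0]
        congr 1
        apply propext
        have hj := j.isLt
        have hq := q.isLt
        simp only [Fin.succAbove, Fin.lt_def, Fin.val_castSucc, Fin.val_rev]
        split_ifs <;> simp only [Fin.val_castSucc, Fin.val_succ] <;> omega
    · have hq := q.isLt
      simp only [Fin.val_last, Fin.val_rev]
      exact ⟨m, by omega⟩
  · intro j _ hj
    rw [Matrix.submatrix_apply, id, hrow, if_neg hj]
    simp
  · simp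

lemma TNN.pluckNonneg_stack {m n : ℕ} {A : Matrix (Fin n) (Fin m) ℝ} (hA : TNN A) :
    PluckNonneg (stack A (W0 m)) := by
  induction m with
  | zero => intro f _; simp
  | succ m ih =>
    intro F hF
    by_cases hl : (F (Fin.last m) : ℕ) < n
    · have hlt : ∀ i, (F i : ℕ) < n := fun i =>
        lt_of_le_of_lt (Fin.le_def.1 (hF.monotone (Fin.le_last i))) hl
      have := (tnn_iff A).1 hA (m + 1) (fun i => ⟨F i, hlt i⟩) id (fun i j h => hF h) strictMono_id
      convert this using 2
      ext i j
      simp [stack, hlt i]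
    · have hL := (F (Fin.last m)).isLt
      have hlt : ∀ i : Fin m, (F i.castSucc : ℕ) < F (Fin.last m) := fun i =>
        Fin.lt_def.1 (hF (Fin.castSucc_lt_last i))
      rw [det_stack_snoc A ⟨F (Fin.last m) - n, by omega⟩
        (fun i => ⟨F i.castSucc, by have := hlt i; omega⟩) F (fun _ => rfl)
        (by simp only; omega) (fun i => by have := hlt i; simp only; omega)]
      exact ih (hA.submatrix strictMono_id (Fin.strictMono_succAbove _)) _ (fun i j h => hF h)

lemma StrictMono.eq_id_of_surjective {k m : ℕ} {g : Fin k → Fin m} (hg : StrictMono g)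
    (hs : Function.Surjective g) (i : Fin k) : (g i : ℕ) = i := by
  have hk : k = m := by
    simpa using Fintype.card_of_bijective ⟨hg.injective, hs⟩
  subst hk
  have : hg.orderIsoOfSurjective g hs = OrderIso.refl _ := Subsingleton.elim _ _
  have := congrArg (fun e : Fin k ≃o Fin k => ((e i : Fin k) : ℕ)) this
  simpa using this

lemma det_submatrix_nonneg_of_stack {m n k : ℕ} (b : ℕ) (A : Matrix (Fin n) (Fin m) ℝ)
    (hA : ∀ f : Fin m → Fin (m + n), StrictMono f → (∀ i, (f i : ℕ) < n + b) →
      0 ≤ ((stack A (W0 m)).submatrix f id).det)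
    (r : Fin k → Fin n) (g : Fin k → Fin m) (hr : StrictMono r) (hg : StrictMono g)
    (hb : ∀ j, j ∉ Set.range g → m - b ≤ (j : ℕ)) :
    0 ≤ (A.submatrix r g).det := by
  induction m generalizing b with
  | zero =>
    have : IsEmpty (Fin k) := ⟨fun i => (g i).elim0⟩
    rw [Matrix.det_isEmpty]
    exact zero_le_one
  | succ m ih =>
    by_cases hs : Function.Surjective g
    · have hk : k = m + 1 := by
        simpa using Fintype.card_of_bijective ⟨hg.injective, hs⟩
      subst hk
      have := hA (fun i => ⟨r i, by have := (r i).isLt; omega⟩) (fun i j h => hr h)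
        (fun i => by have := (r i).isLt; simp only; omega)
      convert this using 2
      ext i j
      have : g j = j := Fin.ext (hg.eq_id_of_surjective hs j)
      simp [stack, this]
    · obtain ⟨j, hj, hmin⟩ : ∃ j, j ∉ Set.range g ∧ ∀ i, i ∉ Set.range g → j ≤ i := by
        have hne : (univ.filter (fun j => j ∉ Set.range g)).Nonempty := by
          by_contra h
          apply hs
          intro j
          by_contra h'
          exact h ⟨j, by simpa using h'⟩
        obtain ⟨j, hj, h⟩ := Finset.exists_min_image _ id hne
        exact ⟨j, by simpa using hj, fun i hi => h i (by simpa using hi)⟩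
      have hg' : ∀ i, ∃ l, j.succAbove l = g i := fun i =>
        Fin.exists_succAbove_eq (fun h => hj ⟨i, h⟩)
      choose g' hg' using hg'
      have hjb := hb j hj
      have hj' := j.isLt
      have key := ih (j.rev : ℕ) (A.submatrix id j.succAbove) ?_ g' ?_ ?_
      · convert key using 2
        ext a c
        simp [hg']
      · intro f hf hfb
        rw [Fin.val_rev] at hfb
        have hdet := det_stack_snoc A j.rev f
          (Fin.snoc (α := fun _ => Fin (m + 1 + n))
            (fun i => ⟨f i, by have := (f i).isLt; omega⟩) ⟨n + j.rev, by omega⟩)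
          (fun i => by simp) (by simp) (fun i => by rw [Fin.val_rev]; exact hfb i)
        rw [Fin.rev_rev] at hdet
        rw [← hdet]
        apply hA
        · intro x y hxy
          induction y using Fin.lastCases with
          | last =>
            induction x using Fin.lastCases with
            | last => exact absurd hxy (lt_irrefl _)
            | cast x =>
              simpa only [Fin.snoc_castSucc, Fin.snoc_last, Fin.lt_def, Fin.val_rev] using hfb x
          | cast y =>
            induction x using Fin.lastCases with
            | last => exact absurd hxy (not_lt.2 (Fin.le_last _))
            | cast x =>
              simpa only [Fin.snoc_castSucc, Fin.lt_def] using
                hf (Fin.castSucc_lt_castSucc_iff.1 hxy)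
        · intro x
          induction x using Fin.lastCases with
          | last => simp; omega
          | cast x => have := hfb x; simp; omega
      · intro x y hxy
        rw [← (Fin.strictMono_succAbove j).lt_iff_lt, hg', hg']
        exact hg hxy
      · intro l hl
        have h1 : j.succAbove l ∉ Set.range g := by
          rintro ⟨i, hi⟩
          exact hl ⟨i, Fin.succAbove_right_injective ((hg' i).trans hi)⟩
        have h2 := Fin.le_def.1 (hmin _ h1)
        have h3 : (j.succAbove l : ℕ) ≠ j := fun h => Fin.succAbove_ne j l (Fin.ext h)
        have h4 : (j.succAbove l : ℕ) ≤ l + 1 := by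
          simp only [Fin.succAbove]
          split_ifs <;> simp
        rw [Fin.val_rev]
        omega

lemma tnn_of_pluckNonneg_stack {m n : ℕ} {A : Matrix (Fin n) (Fin m) ℝ}
    (hA : PluckNonneg (stack A (W0 m))) : TNN A :=
  (tnn_iff A).2 fun _ r g hr hg =>
    det_submatrix_nonneg_of_stack m A (fun f hf _ => hA f hf) r g hr hg (by simp)

/-- The increasing enumeration of the last `m` rows. -/
def lastRows (m n : ℕ) (i : Fin m) : Fin (m + n) := ⟨n + i, by omega⟩

lemma strictMono_lastRows (m n : ℕ) : StrictMono (lastRows m n) := fun _ _ h =>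
  Fin.lt_def.2 (Nat.add_lt_add_left (Fin.lt_def.1 h) n)

lemma stack_lastRows {m n : ℕ} (A : Matrix (Fin n) (Fin m) ℝ) (C : Matrix (Fin m) (Fin m) ℝ) :
    (stack A C).submatrix (lastRows m n) id = C := by
  ext i j
  simp [stack, lastRows]

lemma det_W0 (m : ℕ) : (W0 m).det = 1 := by
  induction m with
  | zero => simp
  | succ m ih =>
    have h := det_stack_snoc (n := 0) 0 (Fin.last m) (lastRows m 0)
      (lastRows (m + 1) 0) (fun i => by simp [lastRows]) (by simp [lastRows])
      (fun i => by simp [lastRows])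
    rwa [stack_lastRows, stack_lastRows, ih] at h

lemma exists_det_submatrix_ne_zero {N m : ℕ} {B : Matrix (Fin N) (Fin m) ℝ} (hB : B.rank = m) :
    ∃ f : Fin m → Fin N, StrictMono f ∧ (B.submatrix f id).det ≠ 0 := by
  rw [Matrix.rank_eq_finrank_span_row] at hB
  obtain ⟨v, hv, -, hli⟩ := Submodule.exists_fun_fin_finrank_span_eq ℝ (Set.range B.row)
  choose g hg using hv
  obtain ⟨g, hg⟩ : ∃ g : Fin m → Fin N, LinearIndependent ℝ (fun i => B.row (g i)) := by
    have hv' : v = fun i => B.row (g i) := funext fun i => (hg i).symm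
    rw [hv'] at hli
    exact ⟨fun i => g (Fin.cast hB.symm i), hli.comp _ (Fin.cast_injective hB.symm)⟩
  have hinj : Function.Injective g := fun x y h => hg.injective (by simp [h])
  refine ⟨g ∘ Tuple.sort g, (Tuple.monotone_sort g).strictMono_of_injective
    (hinj.comp (Tuple.sort g).injective), ?_⟩
  have hli' := hg.comp _ (Tuple.sort g).injective
  have : IsUnit (B.submatrix (g ∘ Tuple.sort g) id) :=
    Matrix.linearIndependent_rows_iff_isUnit.1 hli'
  exact ((Matrix.isUnit_iff_isUnit_det _).1 this).ne_zero

lemma det_submatrix_updateRow {N m : ℕ} (B : Matrix (Fin N) (Fin m) ℝ) (a b : Fin N) (t : ℝ)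
    {f : Fin m → Fin N} (hf : Function.Injective f) {i : Fin m} (hi : f i = b) :
    ((B.updateRow b (B b + t • B a)).submatrix f id).det =
      (B.submatrix f id).det + t * (B.submatrix (Function.update f i a) id).det := by
  have h1 : (B.updateRow b (B b + t • B a)).submatrix f id =
      (B.submatrix f id).updateRow i (B b + t • B a) := by
    ext x y
    by_cases hx : x = i
    · subst hx; simp [hi]
    · have : f x ≠ b := fun h => hx (hf (h.trans hi.symm))
      simp [hx, this]
  have h2 : (B.submatrix f id).updateRow i (B b) = B.submatrix f id := by
    ext x y
    by_cases hx : x = i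
    · subst hx; simp [hi]
    · simp [hx]
  have h3 : (B.submatrix f id).updateRow i (B a) = B.submatrix (Function.update f i a) id := by
    ext x y
    by_cases hx : x = i
    · subst hx; simp
    · simp [hx]
  rw [h1, Matrix.det_updateRow_add, Matrix.det_updateRow_smul, h2, h3]

lemma StrictMono.update_adjacent {N m : ℕ} {f : Fin m → Fin N} (hf : StrictMono f) {i : Fin m}
    {a : Fin N} (ha : a ∉ Set.range f) (hai : (a : ℕ) + 1 = f i ∨ (f i : ℕ) + 1 = a) :
    StrictMono (Function.update f i a) := by
  have hne : ∀ x, (f x : ℕ) ≠ a := fun x h => ha ⟨x, Fin.ext h⟩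
  intro x y hxy
  have h := Fin.lt_def.1 (hf hxy)
  have hx := hne x
  have hy := hne y
  by_cases h1 : x = i <;> by_cases h2 : y = i
  · subst h1 h2; exact absurd hxy (lt_irrefl _)
  · subst h1
    rw [Function.update_self, Function.update_of_ne h2, Fin.lt_def]
    omega
  · subst h2
    rw [Function.update_self, Function.update_of_ne h1, Fin.lt_def]
    omega
  · rwa [Function.update_of_ne h1, Function.update_of_ne h2]

lemma PluckNonneg.updateRow {N m : ℕ} {B : Matrix (Fin N) (Fin m) ℝ} (hB : PluckNonneg B)
    {a b : Fin N} (hab : (a : ℕ) + 1 = b) {t : ℝ} (ht : 0 ≤ t) :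
    PluckNonneg (B.updateRow b (B b + t • B a)) := by
  intro f hf
  by_cases hb : b ∈ Set.range f
  · obtain ⟨i, hi⟩ := hb
    rw [det_submatrix_updateRow B a b t hf.injective hi]
    refine add_nonneg (hB f hf) (mul_nonneg ht ?_)
    by_cases ha : a ∈ Set.range f
    · obtain ⟨l, hl⟩ := ha
      have hli : l ≠ i := by
        rintro rfl
        rw [← hl, ← hi] at hab
        omega
      refine le_of_eq (Matrix.det_zero_of_row_eq hli ?_).symm
      ext y
      simp [Function.update_of_ne hli, hl]
    · exact hB _ (hf.update_adjacent ha (Or.inl (by rw [hi, hab])))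
  · have : (B.updateRow b (B b + t • B a)).submatrix f id = B.submatrix f id := by
      ext x y
      have : f x ≠ b := fun h => hb ⟨x, h⟩
      simp [this]
    rw [this]
    exact hB f hf

lemma exists_adjacent_of_ne_lastRows {m n : ℕ} {f : Fin m → Fin (m + n)} (hf : StrictMono f)
    (hne : f ≠ lastRows m n) :
    ∃ (i : Fin m) (b : Fin (m + n)), (f i : ℕ) + 1 = b ∧ b ∉ Set.range f := by
  have hex : (univ.filter (fun i => f i ≠ lastRows m n i)).Nonempty := by
    obtain ⟨i, hi⟩ := Function.ne_iff.1 hne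
    exact ⟨i, by simpa using hi⟩
  obtain ⟨i, hi, hmax⟩ := Finset.exists_max_image _ id hex
  have hi' : (f i : ℕ) ≠ n + i := fun h => (mem_filter.1 hi).2 (Fin.ext h)
  have hlater : ∀ j, i < j → (f j : ℕ) = n + j := by
    intro j hj
    by_contra h
    exact absurd (hmax j (by simpa [lastRows, Fin.ext_iff] using h)) (not_le.2 hj)
  have hlt : (f i : ℕ) < n + i := by
    by_cases him : (i : ℕ) + 1 < m
    · have h1 := hlater ⟨i + 1, him⟩ (Fin.lt_def.2 (Nat.lt_succ_self _))
      have h2 := Fin.lt_def.1 (hf (show i < ⟨i + 1, him⟩ from Fin.lt_def.2 (Nat.lt_succ_self _)))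
      simp only at h1
      omega
    · have := (f i).isLt
      omega
  refine ⟨i, ⟨f i + 1, by omega⟩, rfl, ?_⟩
  rintro ⟨j, hj⟩
  have hj' : (f j : ℕ) = f i + 1 := congrArg Fin.val hj
  have hij : i < j := hf.lt_iff_lt.1 (Fin.lt_def.2 (by omega))
  have := hlater j hij
  have := Fin.lt_def.1 hij
  omega

/-- Matrices with nonnegative Plücker coordinates are limits of such matrices whose last
Plücker coordinate is positive. -/
lemma PluckNonneg.mem_closure {m n : ℕ} (f : Fin m → Fin (m + n)) (hf : StrictMono f)
    (B : Matrix (Fin (m + n)) (Fin m) ℝ) (hB : PluckNonneg B)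
    (hpos : 0 < (B.submatrix f id).det) :
    B ∈ closure {C : Matrix (Fin (m + n)) (Fin m) ℝ |
      PluckNonneg C ∧ 0 < (C.submatrix (lastRows m n) id).det} := by
  induction hd : ∑ i, (m + n - (f i : ℕ)) using Nat.strong_induction_on generalizing f B with
  | _ d ih =>
    by_cases hl : f = lastRows m n
    · subst hl
      exact subset_closure ⟨hB, hpos⟩
    · obtain ⟨i, b, hib, hb⟩ := exists_adjacent_of_ne_lastRows hf hl
      have hmono := hf.update_adjacent hb (Or.inr hib)
      have hlt : ∑ x, (m + n - (Function.update f i b x : ℕ)) < d := by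
        rw [← hd]
        refine Finset.sum_lt_sum (fun x _ => ?_) ⟨i, mem_univ _, ?_⟩
        · by_cases hx : x = i
          · subst hx; rw [Function.update_self]; omega
          · rw [Function.update_of_ne hx]
        · rw [Function.update_self]
          omega
      have hmem : ∀ t : ℝ, 0 < t → B.updateRow b (B b + t • B (f i)) ∈
          closure {C : Matrix (Fin (m + n)) (Fin m) ℝ |
            PluckNonneg C ∧ 0 < (C.submatrix (lastRows m n) id).det} := by
        intro t ht
        refine ih _ hlt _ hmono _ (hB.updateRow hib ht.le) ?_ rfl
        rw [det_submatrix_updateRow B (f i) b t hmono.injective (Function.update_self i b f)]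
        rw [Function.update_idem, Function.update_eq_self]
        exact add_pos_of_nonneg_of_pos (hB _ hmono) (mul_pos ht hpos)
      have hcont : Continuous fun t : ℝ => B.updateRow b (B b + t • B (f i)) :=
        continuous_const.matrix_updateRow b (by fun_prop)
      have htend : Filter.Tendsto (fun t : ℝ => B.updateRow b (B b + t • B (f i)))
          (nhdsWithin 0 (Set.Ioi 0)) (nhds B) := by
        have := (hcont.tendsto 0).mono_left (nhdsWithin_le_nhds (s := Set.Ioi 0))
        simpa [Matrix.updateRow_eq_self] using this
      exact isClosed_closure.mem_of_tendsto htend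
        (Filter.eventually_of_mem self_mem_nhdsWithin hmem)

lemma continuous_pluck {N m : ℕ} (K : Finset (Fin N)) :
    Continuous fun B : Matrix (Fin N) (Fin m) ℝ => pluck B K := by
  unfold pluck
  split_ifs
  · exact (continuous_id.matrix_submatrix _ _).matrix_det
  · exact continuous_const

lemma pluck_mul {N m : ℕ} (B : Matrix (Fin N) (Fin m) ℝ) (g : Matrix (Fin m) (Fin m) ℝ)
    (K : Finset (Fin N)) : pluck (B * g) K = pluck B K * g.det := by
  unfold pluck
  split_ifs
  · rw [← Matrix.det_mul]
    rfl
  · simp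

/-- Matrices with positive last Plücker coordinate are column equivalent to `stack A W₀`. -/
lemma exists_mul_eq_stack {m n : ℕ} (B : Matrix (Fin (m + n)) (Fin m) ℝ)
    (hB : 0 < (B.submatrix (lastRows m n) id).det) :
    ∃ (g : Matrix (Fin m) (Fin m) ℝ) (A : Matrix (Fin n) (Fin m) ℝ),
      0 < g.det ∧ B * g = stack A (W0 m) := by
  set C := B.submatrix (lastRows m n) id with hC
  have hunit : IsUnit C.det := hB.ne'.isUnit
  refine ⟨C⁻¹ * W0 m, fun i => (B * (C⁻¹ * W0 m)) ⟨i, by omega⟩, ?_, ?_⟩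
  · rw [Matrix.det_mul, det_W0, mul_one, Matrix.det_nonsing_inv, Ring.inverse_eq_inv']
    exact inv_pos.2 hB
  · ext i j
    by_cases hi : (i : ℕ) < n
    · simp [stack, hi]
    · have hCW : C * (C⁻¹ * W0 m) = W0 m := Matrix.mul_nonsing_inv_cancel_left _ _ hunit
      have hi' : lastRows m n ⟨i - n, by omega⟩ = i := by
        ext
        simp only [lastRows]
        omega
      have := congrFun (congrFun hCW ⟨i - n, by omega⟩) j
      simp only [stack, hi, dite_false]
      rw [← this, Matrix.mul_apply, Matrix.mul_apply]
      simp only [hC, Matrix.submatrix_apply, hi', id]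

/-- Soskin–Vishwakarma: equivalence between quadratic determinantal inequalities for totally
nonnegative matrices (through the embedding `A ↦ Ā = (A over W₀)`) and quadratic Plücker
inequalities over the totally nonnegative Grassmannian. -/
theorem stmt_12 (m n : ℕ) (hm : 1 ≤ m) (hmn : m ≤ n)
    {ι : Type} (S : Finset ι) (I J : ι → Finset (Fin (m + n))) (c : ι → ℝ)
    (hcard : ∀ α ∈ S, (I α).card = m ∧ (J α).card = m) :
    (∀ A : Matrix (Fin n) (Fin m) ℝ, TNN A →
        0 ≤ ∑ α ∈ S, c α * pluck (stack A (W0 m)) (I α) * pluck (stack A (W0 m)) (J α)) ↔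
      (∀ B : Matrix (Fin (m + n)) (Fin m) ℝ, B.rank = m →
        (∀ K : Finset (Fin (m + n)), 0 ≤ pluck B K) →
        0 ≤ ∑ α ∈ S, c α * pluck B (I α) * pluck B (J α)) := by
  constructor
  · intro h B hrank hB
    obtain ⟨f, hf, hne⟩ := exists_det_submatrix_ne_zero hrank
    have hB' := (pluckNonneg_iff B).2 hB
    have hclosed : IsClosed {C : Matrix (Fin (m + n)) (Fin m) ℝ |
        0 ≤ ∑ α ∈ S, c α * pluck C (I α) * pluck C (J α)} :=
      isClosed_le continuous_const (continuous_finsetSum _ fun α _ =>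
        (continuous_const.mul (continuous_pluck _)).mul (continuous_pluck _))
    refine closure_minimal ?_ hclosed
      (hB'.mem_closure f hf B ((hB' f hf).lt_of_ne' hne))
    rintro C ⟨hC, hpos⟩
    obtain ⟨g, A, hg, hgA⟩ := exists_mul_eq_stack C hpos
    have hA : TNN A := by
      refine tnn_of_pluckNonneg_stack ((pluckNonneg_iff _).2 fun K => ?_)
      rw [← hgA, pluck_mul]
      exact mul_nonneg ((pluckNonneg_iff C).1 hC K) hg.le
    have hsum := h A hA
    have heq : ∑ α ∈ S, c α * pluck (stack A (W0 m)) (I α) * pluck (stack A (W0 m)) (J α) =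
        (∑ α ∈ S, c α * pluck C (I α) * pluck C (J α)) * (g.det * g.det) := by
      rw [Finset.sum_mul]
      refine Finset.sum_congr rfl fun α _ => ?_
      rw [← hgA, pluck_mul, pluck_mul]
      ring
    rw [heq] at hsum
    exact nonneg_of_mul_nonneg_left hsum (mul_pos hg hg)
  · intro h A hA
    refine h _ ?_ ((pluckNonneg_iff _).1 hA.pluckNonneg_stack)
    apply le_antisymm (Matrix.rank_le_width _)
    have hW : (W0 m).rank = m := by
      simpa using Matrix.rank_of_det_ne_zero (A := W0 m) (by rw [det_W0]; exact one_ne_zero)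
    have := Matrix.rank_submatrix_le (stack A (W0 m)) (lastRows m n) id
    rwa [stack_lastRows, hW] at this
end

section
/- Let 1 ≤ m ≤ n be integers and let 𝒜 be an (m+n)×m real matrix all of whose Plücker coordinates Δ_I(𝒜) are nonzero and have the same sign (equivalently, the column space of 𝒜 lies in the totally positive Grassmannian Gr^{>0}(m,m+n)). Then there exist an (m+n)×(m+n) totally nonnegative matrix Q, an invertible m×m real matrix M, and an n×n permutation matrix P such that the n×m matrix P^T · (I_m stacked over the (n−m)×m zero matrix) is totally nonnegative, and 𝒜 = Q · S · M, where S is the (m+n)×m matrix stacking P^T · (I_m over 0) on top of W_0. -/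
open Finset

/-- The row permutation `P^T · (I_m over 0)` of the `n × m` stack of `I_m` over `0`,
encoded by a permutation `σ` of the rows: entry `1` at `(i, j)` iff `σ i = j` (as naturals). -/
def permStack (m n : ℕ) (σ : Equiv.Perm (Fin n)) : Matrix (Fin n) (Fin m) ℝ :=
  Matrix.of fun i j => if ((σ i : ℕ) = (j : ℕ)) then (1 : ℝ) else 0

/-- A determinant as a linear function of its first row. -/
theorem det_cons_eq_dotProduct {k : ℕ} (a : Fin (k + 1) → ℝ) (f : Fin k → Fin (k + 1) → ℝ) :
    (Matrix.of (Fin.cons a f : Fin (k + 1) → Fin (k + 1) → ℝ)).det =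
      a ⬝ᵥ fun l => (-1) ^ (l : ℕ) * ((Matrix.of f).submatrix id l.succAbove).det := by
  rw [Matrix.det_succ_row_zero]
  refine Finset.sum_congr rfl fun l _ => ?_
  have : (Matrix.of (Fin.cons a f : Fin (k + 1) → Fin (k + 1) → ℝ)).submatrix Fin.succ l.succAbove
      = (Matrix.of f).submatrix id l.succAbove := by
    ext i j; simp
  rw [this]
  simp
  ring

theorem det_cons_eq_det_insertNth {k : ℕ} (j : Fin (k + 1)) (a : Fin (k + 1) → ℝ)
    (f : Fin k → Fin (k + 1) → ℝ) :
    (Matrix.of (Fin.cons a f : Fin (k + 1) → Fin (k + 1) → ℝ)).det =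
      (-1) ^ (j : ℕ) * (Matrix.of (j.insertNth a f : Fin (k + 1) → Fin (k + 1) → ℝ)).det := by
  rw [det_cons_eq_dotProduct, Matrix.det_succ_row _ j, Finset.mul_sum]
  refine Finset.sum_congr rfl fun l _ => ?_
  have : (Matrix.of (j.insertNth a f : Fin (k + 1) → Fin (k + 1) → ℝ)).submatrix
      j.succAbove l.succAbove = (Matrix.of f).submatrix id l.succAbove := by
    ext i j; simp
  rw [this]
  have h : ((-1 : ℝ) ^ (j : ℕ)) * (-1) ^ (j : ℕ) = 1 := by
    rw [← mul_pow]; simp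
  simp only [Matrix.of_apply, Fin.insertNth_apply_same, pow_add]
  linear_combination (-a l * (-1) ^ (l : ℕ) * ((Matrix.of f).submatrix id l.succAbove).det) * h

theorem det_cons_add_sum {k : ℕ} (a : Fin (k + 1) → ℝ) (u : Fin k → ℝ)
    (x : Fin k → Fin (k + 1) → ℝ) :
    (Matrix.of (Fin.cons (a + ∑ b, u b • x b) x : Fin (k + 1) → Fin (k + 1) → ℝ)).det =
      (Matrix.of (Fin.cons a x : Fin (k + 1) → Fin (k + 1) → ℝ)).det := by
  rw [det_cons_eq_dotProduct, add_dotProduct, sum_dotProduct, ← det_cons_eq_dotProduct]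
  refine add_eq_left.2 (Finset.sum_eq_zero fun b _ => ?_)
  rw [smul_dotProduct, ← det_cons_eq_dotProduct,
    Matrix.det_zero_of_row_eq (i := 0) (j := b.succ) (Fin.succ_ne_zero _).symm rfl, smul_zero]

/-- A strictly increasing `J : Fin k → Fin N` with `k < N` omits a least index `p`; inserting it
into the sequence keeps it strictly increasing. -/
theorem StrictMono.exists_insertNth {k N : ℕ} (hk : k < N) {J : Fin k → Fin N}
    (hJ : StrictMono J) :
    ∃ p : Fin (k + 1), (∀ i : Fin k, (i : ℕ) < p → (J i : ℕ) = i) ∧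
      StrictMono (p.insertNth (⟨p, by omega⟩ : Fin N) J : Fin (k + 1) → Fin N) := by
  have hle : ∀ i : Fin k, (i : ℕ) ≤ J i := by
    rintro ⟨i, hi⟩
    induction i with
    | zero => simp
    | succ i ih =>
      have h1 := ih (by omega)
      have h2 : J ⟨i, by omega⟩ < J ⟨i + 1, hi⟩ := hJ (by simp [Fin.lt_def])
      simp only [Fin.lt_def] at h2 h1 ⊢
      omega
  have hex : ∃ p : ℕ, ∀ h : p < k, p < (J ⟨p, h⟩ : ℕ) := ⟨k, fun h => absurd h (lt_irrefl k)⟩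
  classical
  have hpk : Nat.find hex ≤ k := Nat.find_min' hex fun h => absurd h (lt_irrefl k)
  have hlt : ∀ i : Fin k, (i : ℕ) < Nat.find hex → (J i : ℕ) = i := by
    intro i hi
    have h := Nat.find_min hex hi
    push Not at h
    obtain ⟨h', h⟩ := h
    exact le_antisymm h (hle i)
  have hge : ∀ i : Fin k, Nat.find hex ≤ (i : ℕ) → Nat.find hex < (J i : ℕ) := by
    intro i hi
    have h := Nat.find_spec hex (lt_of_le_of_lt hi i.isLt)
    refine lt_of_lt_of_le h ?_
    exact hJ.monotone (by simpa [Fin.le_def] using hi)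
  refine ⟨⟨Nat.find hex, by omega⟩, hlt, (Fin.strictMono_insertNth_iff _ _ _).2 ⟨hJ, ?_, ?_⟩⟩
  · intro i hi
    rw [Fin.lt_def, hlt i hi]
    exact hi
  · exact fun i hi => hge i hi

/-- If all maximal minors of the rows `x` are positive, then prepending the row `∑ (-ε)ⁱ xᵢ` to any
`k` of them in increasing order gives a positive determinant, for small `ε > 0`. -/
theorem eventually_det_cons_pos {k N : ℕ} (hk : k < N) (x : Fin N → Fin (k + 1) → ℝ)
    (hx : ∀ s : Fin (k + 1) → Fin N, StrictMono s → 0 < (Matrix.of (x ∘ s)).det)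
    {J : Fin k → Fin N} (hJ : StrictMono J) :
    ∀ᶠ ε : ℝ in nhdsWithin 0 (Set.Ioi 0), 0 < (Matrix.of
      (Fin.cons (∑ i : Fin N, (-ε) ^ (i : ℕ) • x i) (x ∘ J) :
        Fin (k + 1) → Fin (k + 1) → ℝ)).det := by
  obtain ⟨p, hp, hmono⟩ := hJ.exists_insertNth hk
  set d : Fin N → ℝ := fun i =>
    (Matrix.of (Fin.cons (x i) (x ∘ J) : Fin (k + 1) → Fin (k + 1) → ℝ)).det with hd
  have hd0 : ∀ i : Fin N, (i : ℕ) < p → d i = 0 := by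
    intro i hi
    have hik : (i : ℕ) < k := by omega
    refine Matrix.det_zero_of_row_eq (i := 0) (j := Fin.succ ⟨i, hik⟩) (Fin.succ_ne_zero _).symm ?_
    have : J ⟨i, hik⟩ = i := Fin.ext (hp ⟨i, hik⟩ hi)
    change x i = x (J ⟨i, hik⟩)
    rw [this]
  have hdp : 0 < (-1) ^ (p : ℕ) * d ⟨p, by omega⟩ := by
    have h := hx _ hmono
    have he : x ∘ (p.insertNth (⟨p, by omega⟩ : Fin N) J : Fin (k + 1) → Fin N) =
        p.insertNth (x ⟨p, by omega⟩) (x ∘ J) := by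
      ext i
      cases i using Fin.succAboveCases p <;> simp
    rw [he] at h
    simp only [hd]
    rw [det_cons_eq_det_insertNth p, ← mul_assoc, ← mul_pow]
    simpa using h
  have hdet : ∀ ε : ℝ, (Matrix.of (Fin.cons (∑ i : Fin N, (-ε) ^ (i : ℕ) • x i) (x ∘ J) :
      Fin (k + 1) → Fin (k + 1) → ℝ)).det =
      ε ^ (p : ℕ) * ∑ i : Fin N, (-1) ^ (i : ℕ) * ε ^ ((i : ℕ) - p) * d i := by
    intro ε
    rw [det_cons_eq_dotProduct, sum_dotProduct, Finset.mul_sum]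
    refine Finset.sum_congr rfl fun i _ => ?_
    rw [smul_dotProduct, ← det_cons_eq_dotProduct]
    change _ • d i = _
    rcases lt_or_ge (i : ℕ) p with h | h
    · simp [hd0 i h]
    · rw [neg_pow, ← Nat.sub_add_cancel h, smul_eq_mul]
      simp only [Nat.add_sub_cancel]
      ring
  have hcont : Continuous fun ε : ℝ =>
      ∑ i : Fin N, (-1) ^ (i : ℕ) * ε ^ ((i : ℕ) - p) * d i := by fun_prop
  have h0 : 0 < ∑ i : Fin N, (-1) ^ (i : ℕ) * (0 : ℝ) ^ ((i : ℕ) - p) * d i := by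
    rw [Finset.sum_eq_single (⟨p, by omega⟩ : Fin N)]
    · simpa using hdp
    · intro i _ hi
      rcases lt_or_ge (i : ℕ) p with h | h
      · simp [hd0 i h]
      · have : (i : ℕ) - p ≠ 0 := fun h' => hi (Fin.ext (by simp; omega))
        simp [this]
    · simp
  have hev := (hcont.tendsto 0).eventually (lt_mem_nhds h0)
  filter_upwards [nhdsWithin_le_nhds hev, self_mem_nhdsWithin] with ε h1 h2
  rw [hdet]
  exact mul_pos (pow_pos h2 _) h1

/-- Every minor of `B` (of every size) is positive. -/
def AllMinorsPos {p q : ℕ} (B : Matrix (Fin p) (Fin q) ℝ) : Prop :=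
  ∀ (k : ℕ) (r : Fin k → Fin p) (c : Fin k → Fin q), StrictMono r → StrictMono c →
    0 < (B.submatrix r c).det

theorem AllMinorsPos.exists_column_pos {m N : ℕ} {B : Matrix (Fin N) (Fin m) ℝ}
    (hB : AllMinorsPos B) :
    ∃ u : Fin m → ℝ, ∀ (k : Fin m) (r : Fin (k + 1) → Fin N) (c : Fin k → Fin m),
      StrictMono r → StrictMono c → 0 < (Matrix.of
        (Fin.cons (fun a => (B.mulVec u) (r a)) (fun b a => B (r a) (c b)) :
          Fin (k + 1) → Fin (k + 1) → ℝ)).det := by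
  have hev : ∀ᶠ ε : ℝ in nhdsWithin 0 (Set.Ioi 0), ∀ (k : Fin m) (r : Fin (k + 1) → Fin N)
      (c : Fin k → Fin m), StrictMono r → StrictMono c → 0 < (Matrix.of
        (Fin.cons (∑ i : Fin m, (-ε) ^ (i : ℕ) • fun a => B (r a) i)
          ((fun i a => B (r a) i) ∘ c) : Fin (k + 1) → Fin (k + 1) → ℝ)).det := by
    simp only [Filter.eventually_all]
    intro k r c hr hc
    refine eventually_det_cons_pos k.isLt (fun i a => B (r a) i) (fun s hs => ?_) hc
    have h := hB _ r s hr hs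
    rwa [← Matrix.det_transpose] at h
  obtain ⟨ε, hε⟩ := hev.exists
  refine ⟨fun i => (-ε) ^ (i : ℕ), fun k r c hr hc => ?_⟩
  have h : (fun a => B.mulVec (fun i => (-ε) ^ (i : ℕ)) (r a)) =
      ∑ i : Fin m, (-ε) ^ (i : ℕ) • fun a => B (r a) i := by
    ext a
    simp [Matrix.mulVec, dotProduct, mul_comm]
  rw [h]
  exact hε k r c hr hc

theorem AllMinorsPos.exists_cons_column {m N : ℕ} {B : Matrix (Fin N) (Fin m) ℝ}
    (hB : AllMinorsPos B) (v : Fin N → ℝ)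
    (hv : ∀ r : Fin (m + 1) → Fin N, StrictMono r → 0 < (Matrix.of
      (Fin.cons (fun a => v (r a)) (fun b a => B (r a) b) :
        Fin (m + 1) → Fin (m + 1) → ℝ)).det) :
    ∃ u : Fin m → ℝ, AllMinorsPos (Matrix.of fun i =>
      (Fin.cons (v i + B.mulVec u i) (B i) : Fin (m + 1) → ℝ)) := by
  obtain ⟨u, hu⟩ := hB.exists_column_pos
  have hev : ∀ᶠ t : ℝ in Filter.atTop, ∀ (k : Fin m) (r : Fin (k + 1) → Fin N)
      (c : Fin k → Fin m), StrictMono r → StrictMono c → 0 < (Matrix.of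
        (Fin.cons (fun a => v (r a) + B.mulVec (t • u) (r a)) (fun b a => B (r a) (c b)) :
          Fin (k + 1) → Fin (k + 1) → ℝ)).det := by
    simp only [Filter.eventually_all]
    intro k r c hr hc
    have h := hu k r c hr hc
    have hlim := Filter.tendsto_atTop_add_const_left Filter.atTop (Matrix.of
      (Fin.cons (fun a => v (r a)) (fun b a => B (r a) (c b)) :
        Fin (k + 1) → Fin (k + 1) → ℝ)).det (Filter.tendsto_id.atTop_mul_const h)
    filter_upwards [hlim.eventually_gt_atTop 0] with t ht
    refine ht.trans_eq ?_
    rw [det_cons_eq_dotProduct, det_cons_eq_dotProduct, det_cons_eq_dotProduct, id,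
      ← smul_eq_mul, ← smul_dotProduct, ← add_dotProduct]
    congr 1
    ext a
    simp [Matrix.mulVec_smul]
  obtain ⟨t, ht⟩ := hev.exists
  refine ⟨t • u, fun k r c hr hc => ?_⟩
  cases k with
  | zero => simp
  | succ k =>
    by_cases h0 : c 0 = 0
    · have hne : ∀ i : Fin k, c i.succ ≠ 0 := fun i hi =>
        (Fin.succ_ne_zero i) (hc.injective (hi.trans h0.symm))
      obtain ⟨c', hc'⟩ : ∃ c' : Fin k → Fin m, ∀ i, c i.succ = (c' i).succ :=
        ⟨fun i => (c i.succ).pred (hne i), fun i => (Fin.succ_pred _ _).symm⟩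
      have hmono : StrictMono c' := fun i j hij => by
        have h := hc (Fin.succ_lt_succ_iff.2 hij)
        rwa [hc', hc', Fin.succ_lt_succ_iff] at h
      have hk : k ≤ m := by simpa using Fintype.card_le_of_injective c' hmono.injective
      rw [← Matrix.det_transpose]
      have heq : ((Matrix.of fun i => (Fin.cons (v i + B.mulVec (t • u) i) (B i) :
          Fin (m + 1) → ℝ)).submatrix r c).transpose = Matrix.of
          (Fin.cons (fun a => v (r a) + B.mulVec (t • u) (r a)) (fun b a => B (r a) (c' b)) :
            Fin (k + 1) → Fin (k + 1) → ℝ) := by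
        ext i j
        cases i using Fin.cases <;> simp [h0, hc']
      rw [heq]
      rcases hk.lt_or_eq with hk | rfl
      · exact ht ⟨k, hk⟩ r c' hr hmono
      · have hid : c' = id := hmono.eq_id
        subst hid
        have hsum : (fun a => v (r a) + B.mulVec (t • u) (r a)) =
            (fun a => v (r a)) + ∑ b, (t • u) b • fun a => B (r a) b := by
          ext a
          simp [Matrix.mulVec, dotProduct, mul_comm]
        rw [hsum]
        exact (hv r hr).trans_eq (det_cons_add_sum _ _ _).symm
    · have hne : ∀ i, c i ≠ 0 := fun i hi => h0 (le_antisymm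
        (hi ▸ hc.monotone (Fin.zero_le i)) (Fin.zero_le _))
      obtain ⟨c', hc'⟩ : ∃ c' : Fin (k + 1) → Fin m, ∀ i, c i = (c' i).succ :=
        ⟨fun i => (c i).pred (hne i), fun i => (Fin.succ_pred _ _).symm⟩
      have hmono : StrictMono c' := fun i j hij => by
        have h := hc hij
        rwa [hc', hc', Fin.succ_lt_succ_iff] at h
      convert hB _ r c' hr hmono using 2
      ext i j
      simp [hc']

/-- The column space of a matrix with positive maximal minors has a basis whose matrix has all
minors positive. -/
theorem exists_mul_allMinorsPos {m N : ℕ} (hmN : m ≤ N) (A : Matrix (Fin N) (Fin m) ℝ)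
    (hA : ∀ r : Fin m → Fin N, StrictMono r → 0 < (A.submatrix r id).det) :
    ∃ M : Matrix (Fin m) (Fin m) ℝ, 0 < M.det ∧ AllMinorsPos (A * M) := by
  induction m with
  | zero =>
    refine ⟨1, by simp, fun k r c hr hc => ?_⟩
    have hk : k = 0 := by simpa using Fintype.card_le_of_injective c hc.injective
    subst hk
    simp
  | succ m ih =>
    have hev : ∀ᶠ ε : ℝ in nhdsWithin 0 (Set.Ioi 0), ∀ r : Fin m → Fin N, StrictMono r →
        0 < (Matrix.of (Fin.cons (∑ i : Fin N, (-ε) ^ (i : ℕ) • A i) (A ∘ r) :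
          Fin (m + 1) → Fin (m + 1) → ℝ)).det := by
      simp only [Filter.eventually_all]
      exact fun r hr => eventually_det_cons_pos hmN A hA hr
    obtain ⟨ε, hε⟩ := hev.exists
    generalize (∑ i : Fin N, (-ε) ^ (i : ℕ) • A i) = φ at hε
    set H := Matrix.of (Fin.cons φ (A ∘ Fin.castLE (Nat.le_of_succ_le hmN)) :
      Fin (m + 1) → Fin (m + 1) → ℝ) with hH
    have hHdet : 0 < H.det := hε _ (Fin.strictMono_castLE _)
    have hHu : IsUnit H.det := hHdet.ne'.isUnit
    have hHinv : 0 < H⁻¹.det := by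
      rw [Matrix.det_nonsing_inv, Ring.inverse_eq_inv']
      exact inv_pos.2 hHdet
    have hφ : Matrix.vecMul φ H⁻¹ = Pi.single 0 1 := by
      have h : (H * H⁻¹) 0 = (1 : Matrix (Fin (m + 1)) (Fin (m + 1)) ℝ) 0 := by
        rw [Matrix.mul_nonsing_inv _ hHu]
      rw [Matrix.mul_apply_eq_vecMul] at h
      ext j
      exact (congrFun h j).trans (by simp [Matrix.one_apply, Pi.single_apply, eq_comm])
    set C := A * H⁻¹ with hC
    have hCr : ∀ r : Fin m → Fin N, StrictMono r →
        0 < ((C.submatrix id Fin.succ).submatrix r id).det := by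
      intro r hr
      have h := mul_pos (hε r hr) hHinv
      have hmul : Matrix.of (Fin.cons φ (A ∘ r) : Fin (m + 1) → Fin (m + 1) → ℝ) * H⁻¹ =
          Matrix.of (Fin.cons (Pi.single 0 1) fun i => C (r i) :
            Fin (m + 1) → Fin (m + 1) → ℝ) := by
        ext i j
        cases i using Fin.cases with
        | zero => exact congrFun hφ j
        | succ i => rfl
      rw [← Matrix.det_mul, hmul, det_cons_eq_dotProduct, single_one_dotProduct] at h
      simpa using! h
    obtain ⟨M', hM', hpos⟩ := ih (Nat.le_of_succ_le hmN) (C.submatrix id Fin.succ) hCr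
    have hdet : ∀ w : Fin m → ℝ, (Matrix.of
        (Fin.cons (Fin.cons 1 0) fun i => Fin.cons (w i) (M' i)) :
        Matrix (Fin (m + 1)) (Fin (m + 1)) ℝ).det = M'.det := by
      intro w
      have h : (Fin.cons 1 0 : Fin (m + 1) → ℝ) = Pi.single 0 1 := by
        ext j
        cases j using Fin.cases <;> simp
      rw [h, det_cons_eq_dotProduct, single_one_dotProduct]
      simp only [Fin.val_zero, pow_zero, one_mul]
      rfl
    have hmul : ∀ w : Fin m → ℝ, C * (Matrix.of
        (Fin.cons (Fin.cons 1 0) fun i => Fin.cons (w i) (M' i)) :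
        Matrix (Fin (m + 1)) (Fin (m + 1)) ℝ) = Matrix.of fun i =>
        (Fin.cons (C i 0 + (C.submatrix id Fin.succ).mulVec w i)
          ((C.submatrix id Fin.succ * M') i) : Fin (m + 1) → ℝ) := by
      intro w
      ext i j
      rw [Matrix.mul_apply, Fin.sum_univ_succ]
      cases j using Fin.cases <;> simp [Matrix.mulVec, dotProduct, Matrix.mul_apply]
    obtain ⟨u, hu⟩ := hpos.exists_cons_column (fun i => C i 0) (fun r hr => by
      have h := mul_pos (mul_pos (hA r hr) hHinv) ((hdet 0).symm ▸ hM')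
      rw [← Matrix.det_mul, ← Matrix.det_mul] at h
      have hr' : A.submatrix r id * H⁻¹ = C.submatrix r id := rfl
      rw [hr'] at h
      change 0 < ((C * Matrix.of (Fin.cons (Fin.cons 1 0) fun i => Fin.cons ((0 : Fin m → ℝ) i)
        (M' i)) : Matrix (Fin N) (Fin (m + 1)) ℝ).submatrix r id).det at h
      rw [hmul, ← Matrix.det_transpose] at h
      convert h using 2
      ext i j
      cases i using Fin.cases <;> simp)
    refine ⟨H⁻¹ * Matrix.of (Fin.cons (Fin.cons 1 0) fun i => Fin.cons (M'.mulVec u i) (M' i)),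
      ?_, ?_⟩
    · rw [Matrix.det_mul, hdet]
      exact mul_pos hHinv hM'
    · rw [← Matrix.mul_assoc, ← hC, hmul, Matrix.mulVec_mulVec]
      exact hu

theorem tnn_of_submatrix_det_nonneg {p q : ℕ} {B : Matrix (Fin p) (Fin q) ℝ}
    (h : ∀ (k : ℕ) (r : Fin k → Fin p) (c : Fin k → Fin q), StrictMono r → StrictMono c →
      0 ≤ (B.submatrix r c).det) : TNN B := by
  intro I J
  unfold minor
  split_ifs with hc
  · exact h _ _ _ (fun _ _ hab => (I.orderIsoOfFin rfl).strictMono hab)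
      (fun _ _ hab => (J.orderIsoOfFin hc).strictMono hab)
  · exact le_rfl

theorem AllMinorsPos.tnn_pad {p q s : ℕ} {B : Matrix (Fin p) (Fin q) ℝ} (hB : AllMinorsPos B) :
    TNN (Matrix.of fun i (j : Fin s) => if h : (j : ℕ) < q then B i ⟨j, h⟩ else 0) := by
  refine tnn_of_submatrix_det_nonneg fun k r c hr hc => ?_
  by_cases h : ∀ b, (c b : ℕ) < q
  · have := hB k r (fun b => ⟨c b, h b⟩) hr fun _ _ hab => hc hab
    refine this.le.trans_eq (congrArg Matrix.det ?_)
    ext a b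
    simp [h b]
  · push Not at h
    obtain ⟨b, hb⟩ := h
    exact (Matrix.det_eq_zero_of_column_eq_zero b fun a => by simp [hb]).ge

theorem tnn_permStack_one (m n : ℕ) : TNN (permStack m n 1) := by
  refine tnn_of_submatrix_det_nonneg fun k r c hr hc => ?_
  by_cases h : ∀ a, ∃ b, (r a : ℕ) = c b
  · choose g hg using h
    have hmono : StrictMono g := fun a b hab => by
      have h1 : (r a : ℕ) < r b := hr hab
      rw [hg, hg] at h1
      exact hc.lt_iff_lt.1 h1
    have hid := hmono.eq_id
    have : (permStack m n 1).submatrix r c = 1 := by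
      ext a b
      simp [permStack, hg, hid, Matrix.one_apply, ← Fin.ext_iff, hc.injective.eq_iff]
    simp [this]
  · push Not at h
    obtain ⟨a, ha⟩ := h
    exact (Matrix.det_eq_zero_of_row_eq_zero a fun b => by simp [permStack, ha b]).ge

theorem submatrix_det_of_pluck {N m : ℕ} {A : Matrix (Fin N) (Fin m) ℝ} {P : ℝ → Prop}
    (h : ∀ I : Finset (Fin N), I.card = m → P (pluck A I)) (r : Fin m → Fin N)
    (hr : StrictMono r) : P (A.submatrix r id).det := by
  have hcard : (univ.image r).card = m := by
    rw [Finset.card_image_of_injective _ hr.injective]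
    simp
  have hI := h _ hcard
  rw [pluck, dif_pos hcard] at hI
  have heq : r = fun k => (((univ.image r).orderIsoOfFin hcard k : univ.image r) : Fin N) :=
    Finset.orderEmbOfFin_unique hcard (fun k => by simp) hr
  rwa [← heq] at hI

/-- Every representative matrix of a point of the totally positive Grassmannian (all Plücker
coordinates nonzero of the same sign) factors as `Q · S · M` with `Q` totally nonnegative,
`M` invertible, and `S` the stack of a TNN row-permuted `(I_m over 0)` on top of `W₀`. -/
theorem stmt_13 (m n : ℕ) (hm : 1 ≤ m) (hmn : m ≤ n)
    (A : Matrix (Fin (m + n)) (Fin m) ℝ)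
    (hnz : ∀ I : Finset (Fin (m + n)), I.card = m → pluck A I ≠ 0)
    (hsign : (∀ I : Finset (Fin (m + n)), I.card = m → 0 < pluck A I) ∨
      (∀ I : Finset (Fin (m + n)), I.card = m → pluck A I < 0)) :
    ∃ (Q : Matrix (Fin (m + n)) (Fin (m + n)) ℝ) (M : Matrix (Fin m) (Fin m) ℝ)
      (σ : Equiv.Perm (Fin n)),
      TNN Q ∧ IsUnit M ∧ TNN (permStack m n σ) ∧
        A = Q * stack (permStack m n σ) (W0 m) * M := by
  obtain ⟨D, hD, hpos⟩ : ∃ D : Matrix (Fin m) (Fin m) ℝ, IsUnit D ∧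
      ∀ r : Fin m → Fin (m + n), StrictMono r → 0 < ((A * D).submatrix r id).det := by
    rcases hsign with hs | hs
    · exact ⟨1, isUnit_one, by simpa using submatrix_det_of_pluck hs⟩
    · have hdet : (Matrix.diagonal (Function.update 1 (⟨0, hm⟩ : Fin m) (-1 : ℝ))).det = -1 := by
        rw [Matrix.det_diagonal, Finset.prod_update_of_mem (Finset.mem_univ _)]
        simp
      refine ⟨_, (Matrix.isUnit_iff_isUnit_det _).2 (by rw [hdet]; simp), fun r hr => ?_⟩
      change 0 < (A.submatrix r id * Matrix.diagonal _).det
      rw [Matrix.det_mul, hdet]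
      have h : (A.submatrix r id).det < 0 := submatrix_det_of_pluck (P := (· < 0)) hs r hr
      linarith
  obtain ⟨M, hM, hB⟩ := exists_mul_allMinorsPos (Nat.le_add_right m n) (A * D) hpos
  have hDM : IsUnit (D * M) := hD.mul ((Matrix.isUnit_iff_isUnit_det _).2 hM.ne'.isUnit)
  refine ⟨Matrix.of fun i j => if h : (j : ℕ) < m then (A * D * M) i ⟨j, h⟩ else 0,
    (D * M)⁻¹, 1, hB.tnn_pad, (Matrix.isUnit_nonsing_inv_iff).2 hDM, tnn_permStack_one m n, ?_⟩
  have hS : (Matrix.of fun i j => if h : (j : ℕ) < m then (A * D * M) i ⟨j, h⟩ else 0 :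
      Matrix (Fin (m + n)) (Fin (m + n)) ℝ) * stack (permStack m n 1) (W0 m) = A * (D * M) := by
    rw [← Matrix.mul_assoc]
    ext i j
    rw [Matrix.mul_apply, Finset.sum_eq_single (Fin.castAdd n j)]
    · have hj : (j : ℕ) < n := by omega
      simp [stack, permStack, hj]
    · intro l _ hl
      by_cases h : (l : ℕ) < m
      · have hln : (l : ℕ) < n := by omega
        have hne : (l : ℕ) ≠ j := fun h' => hl (Fin.ext h')
        simp [stack, permStack, hln, hne]
      · simp [h]
    · simp
  rw [hS, Matrix.mul_assoc, Matrix.mul_nonsing_inv _ ((Matrix.isUnit_iff_isUnit_det _).1 hDM),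
    Matrix.mul_one]
end

section
/- Let m ≥ 1 be an integer. The set of m×m totally positive real matrices is dense in the set of m×m totally nonnegative real matrices: for every m×m totally nonnegative matrix A and every ε > 0 there exists an m×m totally positive matrix B with ‖A − B‖_F < ε in the Frobenius norm. -/
open Finset

/-- A real matrix is totally positive: every (square) minor is positive. -/
def TP {p q : ℕ} (A : Matrix (Fin p) (Fin q) ℝ) : Prop :=
  ∀ (I : Finset (Fin p)) (J : Finset (Fin q)), J.card = I.card → 0 < minor A I J

/-- The Frobenius norm of a real matrix. -/
noncomputable def frob {p q : ℕ} (A : Matrix (Fin p) (Fin q) ℝ) : ℝ :=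
  Real.sqrt (∑ i, ∑ j, (A i j) ^ 2)

open Matrix Filter Topology

/-- Every minor is nonnegative, with rows and columns selected by strictly increasing maps. -/
def NonnegMinors {p q : ℕ} (A : Matrix (Fin p) (Fin q) ℝ) : Prop :=
  ∀ (k : ℕ) (f : Fin k → Fin p) (g : Fin k → Fin q), StrictMono f → StrictMono g →
    0 ≤ (A.submatrix f g).det

/-- Every minor of order at most `n` is positive. -/
def PosMinorsUpTo {p q : ℕ} (n : ℕ) (A : Matrix (Fin p) (Fin q) ℝ) : Prop :=
  ∀ (k : ℕ) (f : Fin k → Fin p) (g : Fin k → Fin q), k ≤ n → StrictMono f → StrictMono g →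
    0 < (A.submatrix f g).det

theorem minor_eq_det_submatrix {p q k : ℕ} (A : Matrix (Fin p) (Fin q) ℝ)
    (I : Finset (Fin p)) (J : Finset (Fin q)) (hI : I.card = k) (hJ : J.card = k) :
    minor A I J = (A.submatrix (I.orderEmbOfFin hI) (J.orderEmbOfFin hJ)).det := by
  subst hI
  rw [minor, dif_pos hJ]
  rfl

theorem TNN.nonnegMinors {p q : ℕ} {A : Matrix (Fin p) (Fin q) ℝ} (hA : TNN A) :
    NonnegMinors A := by
  intro k f g hf hg
  have hI : (univ.image f).card = k := by simp [card_image_of_injective _ hf.injective]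
  have hJ : (univ.image g).card = k := by simp [card_image_of_injective _ hg.injective]
  have h := hA (univ.image f) (univ.image g)
  rwa [minor_eq_det_submatrix A _ _ hI hJ,
    ← orderEmbOfFin_unique hI (fun x => mem_image_of_mem f (mem_univ x)) hf,
    ← orderEmbOfFin_unique hJ (fun x => mem_image_of_mem g (mem_univ x)) hg] at h

theorem PosMinorsUpTo.tp {p q : ℕ} {A : Matrix (Fin p) (Fin q) ℝ} (hA : PosMinorsUpTo p A) :
    TP A := by
  intro I J h
  rw [minor_eq_det_submatrix A I J rfl h]
  exact hA _ _ _ (by simpa using card_le_univ I) (OrderEmbedding.strictMono _)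
    (OrderEmbedding.strictMono _)

/-- The Cauchy–Binet formula, summed over all (not only increasing) selections of indices. -/
theorem factorial_mul_det_mul {R ι : Type*} [CommRing R] [Fintype ι] [DecidableEq ι] {k : ℕ}
    (M : Matrix (Fin k) ι R) (N : Matrix ι (Fin k) R) :
    (k.factorial : R) * (M * N).det =
      ∑ p : Fin k → ι, (M.submatrix id p).det * (N.submatrix p id).det := by
  have expand : (M * N).det = ∑ p : Fin k → ι, (∏ i, M i (p i)) * (N.submatrix p id).det := by
    have hrow : (M * N) = fun i => ∑ j, M i j • N j := by
      ext i j
      simp [Matrix.mul_apply]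
    have h := (detRowAlternating (n := Fin k) (R := R)).toMultilinearMap.map_sum
      (fun i j => M i j • N j)
    rw [hrow]
    refine h.trans (sum_congr rfl fun p _ => ?_)
    exact MultilinearMap.map_smul_univ _ (fun i => M i (p i)) (fun i => N (p i))
  have hσ (σ : Equiv.Perm (Fin k)) :
      ∑ p : Fin k → ι, (Equiv.Perm.sign σ : R) * (∏ i, M i (p (σ i))) * (N.submatrix p id).det
        = (M * N).det := by
    rw [expand, ← (Equiv.arrowCongr σ (Equiv.refl ι)).sum_comp]
    refine sum_congr rfl fun p _ => ?_
    have h1 : N.submatrix (Equiv.arrowCongr σ (Equiv.refl ι) p) id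
        = (N.submatrix p id).submatrix (σ⁻¹ : Equiv.Perm (Fin k)) id := rfl
    have h2 : ((Equiv.Perm.sign σ : ℤ) : R) * ((Equiv.Perm.sign σ : ℤ) : R) = 1 := by
      rw [← Int.cast_mul, ← Units.val_mul, Int.units_mul_self]
      simp
    rw [h1, det_permute, Equiv.Perm.sign_inv]
    simp only [Equiv.arrowCongr_apply, Function.comp, Equiv.refl_apply, Equiv.symm_apply_apply]
    linear_combination (∏ i, M i (p i)) * (N.submatrix p id).det * h2
  have hdet (p : Fin k → ι) : (M.submatrix id p).det
      = ∑ σ : Equiv.Perm (Fin k), (Equiv.Perm.sign σ : R) * ∏ i, M i (p (σ i)) := by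
    rw [← det_transpose, det_apply']
    rfl
  simp_rw [hdet, sum_mul]
  rw [sum_comm]
  simp_rw [hσ]
  simp [Fintype.card_perm]

theorem exists_perm_strictMono {k n : ℕ} {p : Fin k → Fin n} (hp : Function.Injective p) :
    ∃ σ : Equiv.Perm (Fin k), StrictMono (p ∘ σ) :=
  ⟨Tuple.sort p, (Tuple.monotone_sort p).strictMono_of_injective
    (hp.comp (Tuple.sort p).injective)⟩

theorem det_submatrix_mul_det_submatrix_nonneg {k n : ℕ} {M : Matrix (Fin k) (Fin n) ℝ}
    {N : Matrix (Fin n) (Fin k) ℝ}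
    (hM : ∀ p : Fin k → Fin n, StrictMono p → 0 ≤ (M.submatrix id p).det)
    (hN : ∀ p : Fin k → Fin n, StrictMono p → 0 ≤ (N.submatrix p id).det) (p : Fin k → Fin n) :
    0 ≤ (M.submatrix id p).det * (N.submatrix p id).det := by
  by_cases hp : Function.Injective p
  · obtain ⟨σ, hσ⟩ := exists_perm_strictMono hp
    have h := mul_nonneg (hM _ hσ) (hN _ hσ)
    have h1 : M.submatrix id (p ∘ σ) = (M.submatrix id p).submatrix id σ := rfl
    have h2 : N.submatrix (p ∘ σ) id = (N.submatrix p id).submatrix σ id := rfl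
    have h3 : ((Equiv.Perm.sign σ : ℤ) : ℝ) * ((Equiv.Perm.sign σ : ℤ) : ℝ) = 1 := by
      rw [← Int.cast_mul, ← Units.val_mul, Int.units_mul_self]
      simp
    rw [h1, h2, det_permute, det_permute'] at h
    linear_combination h + (M.submatrix id p).det * (N.submatrix p id).det * h3
  · obtain ⟨i, j, hij, hne⟩ : ∃ i j, p i = p j ∧ i ≠ j := by
      simpa [Function.Injective] using hp
    rw [det_zero_of_row_eq (M := N.submatrix p id) hne (by ext; simp [hij]), mul_zero]

theorem det_mul_nonneg_of_minors {k n : ℕ} {M : Matrix (Fin k) (Fin n) ℝ}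
    {N : Matrix (Fin n) (Fin k) ℝ}
    (hM : ∀ p : Fin k → Fin n, StrictMono p → 0 ≤ (M.submatrix id p).det)
    (hN : ∀ p : Fin k → Fin n, StrictMono p → 0 ≤ (N.submatrix p id).det) :
    0 ≤ (M * N).det := by
  refine nonneg_of_mul_nonneg_right (a := (k.factorial : ℝ)) ?_ (by positivity)
  rw [factorial_mul_det_mul]
  exact sum_nonneg fun p _ => det_submatrix_mul_det_submatrix_nonneg hM hN p

theorem det_mul_pos_of_minors {k n : ℕ} {M : Matrix (Fin k) (Fin n) ℝ}
    {N : Matrix (Fin n) (Fin k) ℝ}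
    (hM : ∀ p : Fin k → Fin n, StrictMono p → 0 ≤ (M.submatrix id p).det)
    (hN : ∀ p : Fin k → Fin n, StrictMono p → 0 ≤ (N.submatrix p id).det)
    (p : Fin k → Fin n) (hMp : 0 < (M.submatrix id p).det) (hNp : 0 < (N.submatrix p id).det) :
    0 < (M * N).det := by
  refine pos_of_mul_pos_right (a := (k.factorial : ℝ)) ?_ (by positivity)
  rw [factorial_mul_det_mul]
  exact sum_pos' (fun p _ => det_submatrix_mul_det_submatrix_nonneg hM hN p)
    ⟨p, mem_univ p, mul_pos hMp hNp⟩

theorem NonnegMinors.mul {p q r : ℕ} {A : Matrix (Fin p) (Fin q) ℝ} {B : Matrix (Fin q) (Fin r) ℝ}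
    (hA : NonnegMinors A) (hB : NonnegMinors B) : NonnegMinors (A * B) := fun k f g hf hg =>
  det_mul_nonneg_of_minors (M := A.submatrix f id) (N := B.submatrix id g)
    (fun p hp => hA k f p hf hp) (fun p hp => hB k p g hp hg)

/-- Multiplying a totally nonnegative matrix on both sides by totally positive matrices makes
every minor of a given order positive as soon as one minor of that order is. -/
theorem det_submatrix_mul_mul_pos {p q k : ℕ} {A : Matrix (Fin p) (Fin q) ℝ}
    {G : Matrix (Fin p) (Fin p) ℝ} {H : Matrix (Fin q) (Fin q) ℝ} (hA : NonnegMinors A)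
    (hG : ∀ n, PosMinorsUpTo n G) (hH : ∀ n, PosMinorsUpTo n H)
    {f₀ : Fin k → Fin p} {g₀ : Fin k → Fin q} (hf₀ : StrictMono f₀) (hg₀ : StrictMono g₀)
    (h₀ : 0 < (A.submatrix f₀ g₀).det)
    {f : Fin k → Fin p} {g : Fin k → Fin q} (hf : StrictMono f) (hg : StrictMono g) :
    0 < ((G * A * H).submatrix f g).det := by
  have hG' : NonnegMinors G := fun k f g hf hg => (hG k k f g le_rfl hf hg).le
  refine det_mul_pos_of_minors (M := (G * A).submatrix f id) (N := H.submatrix id g)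
    (fun r hr => hG'.mul hA k f r hf hr) (fun r hr => (hH k k r g le_rfl hr hg).le) g₀ ?_
    (hH k k g₀ g le_rfl hg₀ hg)
  exact det_mul_pos_of_minors (M := G.submatrix f id) (N := A.submatrix id g₀)
    (fun r hr => hG' k f r hf hr) (fun r hr => hA k r g₀ hr hg₀) f₀ (hG k k f f₀ le_rfl hf hf₀) h₀

theorem det_cauchy_pos {k : ℕ} {x y : Fin k → ℝ} (hx : StrictMono x) (hy : StrictMono y)
    (hx0 : ∀ i, 0 < x i) (hy0 : ∀ i, 0 < y i) :
    0 < (Matrix.of fun i j => 1 / (x i + y j)).det := by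
  induction k with
  | zero => simp
  | succ k ih =>
    have hne (i j) : x i + y j ≠ 0 := (add_pos (hx0 i) (hy0 j)).ne'
    let B : Matrix (Fin (k + 1)) (Fin (k + 1)) ℝ := Matrix.of fun i j =>
      if i = 0 then 1 / (x 0 + y j)
      else ((x i - x 0) / (x i + y 0)) * (((y j - y 0) / (x 0 + y j)) * (1 / (x i + y j)))
    have hB : (Matrix.of fun i j => 1 / (x i + y j)).det = B.det := by
      refine det_eq_of_forall_row_eq_smul_add_const
        (fun i => if i = 0 then 0 else (x 0 + y 0) / (x i + y 0)) 0 (by simp) fun i j => ?_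
      by_cases hi : i = 0
      · simp [B, hi]
      · have h1 := hne i j
        have h2 := hne i 0
        have h3 := hne 0 j
        simp only [B, of_apply, hi, if_false, if_true]
        field_simp
        ring
    have hsub : B.submatrix (Fin.succAbove 0) Fin.succ = Matrix.of fun i j : Fin k =>
        ((x i.succ - x 0) / (x i.succ + y 0)) * (Matrix.of (fun i j : Fin k =>
          ((y j.succ - y 0) / (x 0 + y j.succ)) * (Matrix.of fun i j : Fin k =>
            1 / (x i.succ + y j.succ)) i j)) i j := by
      ext i j
      simp [B]
    rw [hB, det_succ_column_zero, Fin.sum_univ_succ, sum_eq_zero, add_zero, hsub, det_mul_column,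
      det_mul_row]
    · have h := ih (hx.comp (Fin.strictMono_succ)) (hy.comp (Fin.strictMono_succ))
        (fun i => hx0 _) (fun i => hy0 _)
      have h0 : 0 < B 0 0 := by
        have := add_pos (hx0 0) (hy0 0)
        simpa [B] using this
      refine mul_pos (by simpa using h0) (mul_pos (prod_pos fun i _ => ?_)
        (mul_pos (prod_pos fun i _ => ?_) h))
      · exact div_pos (sub_pos.2 (hx (Fin.succ_pos i))) (add_pos (hx0 _) (hy0 _))
      · exact div_pos (sub_pos.2 (hy (Fin.succ_pos i))) (add_pos (hx0 _) (hy0 _))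
    · intro i _
      simp [B]

/-- A rescaled Cauchy matrix with unit diagonal, close to the identity for large `s`. -/
noncomputable def scaledCauchy (n : ℕ) (s : ℝ) : Matrix (Fin n) (Fin n) ℝ :=
  Matrix.of fun i j =>
    2 * s ^ (i : ℕ) * (s ^ (j : ℕ) * (1 / (s ^ (2 * (i : ℕ)) + s ^ (2 * (j : ℕ)))))

theorem scaledCauchy_posMinors (n : ℕ) {s : ℝ} (hs : 1 < s) (d : ℕ) :
    PosMinorsUpTo d (scaledCauchy n s) := by
  intro k f g _ hf hg
  have hs0 : 0 < s := by linarith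
  have heq : (scaledCauchy n s).submatrix f g = Matrix.of fun i j : Fin k =>
      (2 * s ^ (f i : ℕ)) * (Matrix.of (fun i j : Fin k => s ^ (g j : ℕ) *
        (Matrix.of fun i j : Fin k =>
          1 / (s ^ (2 * (f i : ℕ)) + s ^ (2 * (g j : ℕ)))) i j)) i j := rfl
  have hmono {f : Fin k → Fin n} (hf : StrictMono f) :
      StrictMono fun i => s ^ (2 * (f i : ℕ)) := fun i j hij =>
    pow_lt_pow_right₀ hs (by have : (f i : ℕ) < f j := hf hij; omega)
  rw [heq, det_mul_column, det_mul_row]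
  exact mul_pos (prod_pos fun i _ => by positivity) (mul_pos (prod_pos fun i _ => by positivity)
    (det_cauchy_pos (hmono hf) (hmono hg) (fun i => by positivity) (fun i => by positivity)))

theorem tendsto_scaledCauchy (n : ℕ) : Tendsto (scaledCauchy n) atTop (𝓝 1) := by
  have hlt {a b : ℕ} (hab : a < b) : Tendsto (fun s : ℝ =>
      2 * s ^ a * (s ^ b * (1 / (s ^ (2 * a) + s ^ (2 * b))))) atTop (𝓝 0) := by
    have h2 : Tendsto (fun s : ℝ => 2 / s) atTop (𝓝 0) := tendsto_const_nhds.div_atTop tendsto_id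
    refine squeeze_zero' ?_ ?_ h2
    · filter_upwards [eventually_gt_atTop 1] with s hs
      have hs0 : 0 < s := by linarith
      positivity
    · filter_upwards [eventually_gt_atTop 1] with s hs
      have hs0 : 0 < s := by linarith
      have h3 : s ^ (a + b + 1) ≤ s ^ (2 * b) := pow_le_pow_right₀ hs.le (by omega)
      have h4 : 0 < s ^ (2 * a) := by positivity
      have h5 : 2 * s ^ a * (s ^ b * (1 / (s ^ (2 * a) + s ^ (2 * b))))
          = 2 * s ^ (a + b) / (s ^ (2 * a) + s ^ (2 * b)) := by
        rw [pow_add]; ring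
      rw [h5, div_le_div_iff₀ (by positivity) hs0]
      rw [pow_succ] at h3
      nlinarith
  refine tendsto_pi_nhds.2 fun i => tendsto_pi_nhds.2 fun j => ?_
  rcases lt_trichotomy i j with h | rfl | h
  · rw [one_apply_ne h.ne]
    exact hlt h
  · rw [one_apply_eq]
    refine tendsto_const_nhds.congr' ?_
    filter_upwards [eventually_gt_atTop 0] with s hs
    simp only [scaledCauchy, of_apply]
    field_simp
    ring
  · rw [one_apply_ne h.ne']
    refine (hlt h).congr fun s => ?_
    simp only [scaledCauchy, of_apply]
    ring

/-- Increasing the top left entry by `t` changes the minors that meet it by `t` times the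
complementary minor. -/
theorem det_add_single_zero {k : ℕ} (A : Matrix (Fin (k + 1)) (Fin (k + 1)) ℝ) (t : ℝ) :
    (A + Matrix.single 0 0 t).det = A.det + t * (A.submatrix Fin.succ Fin.succ).det := by
  rw [det_succ_row_zero, det_succ_row_zero A, Fin.sum_univ_succ, Fin.sum_univ_succ]
  have hsub (j : Fin (k + 1)) : (A + Matrix.single 0 0 t).submatrix Fin.succ j.succAbove
      = A.submatrix Fin.succ j.succAbove := by
    ext a b
    simp [(Fin.succ_ne_zero a).symm]
  simp only [hsub, Matrix.add_apply, Matrix.single_apply]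
  simp [(Fin.succ_ne_zero _).symm]
  ring

theorem det_submatrix_add_single {n k : ℕ} (A : Matrix (Fin (n + 1)) (Fin (n + 1)) ℝ) (t : ℝ)
    {f g : Fin (k + 1) → Fin (n + 1)} (hf : StrictMono f) (hg : StrictMono g) (hf0 : f 0 = 0)
    (hg0 : g 0 = 0) :
    ((A + Matrix.single 0 0 t).submatrix f g).det = (A.submatrix f g).det +
      t * (A.submatrix (f ∘ Fin.succ) (g ∘ Fin.succ)).det := by
  have h : (A + Matrix.single 0 0 t).submatrix f g = A.submatrix f g + Matrix.single 0 0 t := by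
    ext a b
    have ha : 0 = f a ↔ 0 = a := by rw [← hf0, hf.injective.eq_iff]
    have hb : 0 = g b ↔ 0 = b := by rw [← hg0, hg.injective.eq_iff]
    simp [Matrix.single_apply, ha, hb]
  rw [h, det_add_single_zero]
  rfl

theorem NonnegMinors.add_single {n : ℕ} {A : Matrix (Fin (n + 1)) (Fin (n + 1)) ℝ}
    (hA : NonnegMinors A) {t : ℝ} (ht : 0 ≤ t) :
    NonnegMinors (A + Matrix.single 0 0 t) := by
  intro k f g hf hg
  cases k with
  | zero => simp
  | succ k =>
    by_cases h0 : f 0 = 0 ∧ g 0 = 0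
    · rw [det_submatrix_add_single A t hf hg h0.1 h0.2]
      exact add_nonneg (hA _ _ _ hf hg) (mul_nonneg ht
        (hA _ _ _ (hf.comp Fin.strictMono_succ) (hg.comp Fin.strictMono_succ)))
    · have h : (A + Matrix.single 0 0 t).submatrix f g = A.submatrix f g := by
        ext a b
        have : ¬ (0 = f a ∧ 0 = g b) := by
          rintro ⟨ha, hb⟩
          refine h0 ⟨?_, ?_⟩
          · exact Fin.le_zero_iff.1 ((hf.monotone (Fin.zero_le a)).trans_eq ha.symm)
          · exact Fin.le_zero_iff.1 ((hg.monotone (Fin.zero_le b)).trans_eq hb.symm)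
        simp [this]
      rw [h]
      exact hA _ _ _ hf hg

theorem PosMinorsUpTo.add_single {n d k : ℕ} {A : Matrix (Fin (n + 1)) (Fin (n + 1)) ℝ}
    (hA : NonnegMinors A) (hd : PosMinorsUpTo d A) {t : ℝ} (ht : 0 < t) (hk : k ≤ d + 1)
    (hkn : k ≤ n + 1) :
    0 < ((A + Matrix.single 0 0 t).submatrix (Fin.castLE hkn) (Fin.castLE hkn)).det := by
  have hmono := Fin.strictMono_castLE hkn
  cases k with
  | zero => simp
  | succ k =>
    rw [det_submatrix_add_single A t hmono hmono rfl rfl]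
    exact add_pos_of_nonneg_of_pos (hA _ _ _ hmono hmono) (mul_pos ht (hd _ _ _ (by omega)
      (hmono.comp Fin.strictMono_succ) (hmono.comp Fin.strictMono_succ)))

theorem mem_closure_posMinors_succ {n d : ℕ} {A : Matrix (Fin (n + 1)) (Fin (n + 1)) ℝ}
    (hA : NonnegMinors A) (hd : PosMinorsUpTo d A) :
    A ∈ closure {B : Matrix (Fin (n + 1)) (Fin (n + 1)) ℝ |
      NonnegMinors B ∧ PosMinorsUpTo (d + 1) B} := by
  let F : ℝ → Matrix (Fin (n + 1)) (Fin (n + 1)) ℝ := fun s =>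
    scaledCauchy (n + 1) s * (A + Matrix.single 0 0 s⁻¹) * scaledCauchy (n + 1) s
  have hcont : Continuous fun t : ℝ => A + Matrix.single (0 : Fin (n + 1)) (0 : Fin (n + 1)) t := by
    refine continuous_const.add (continuous_matrix fun i j => ?_)
    simp only [Matrix.single_apply]
    split_ifs <;> fun_prop
  have hF : Tendsto F atTop (𝓝 A) := by
    have h1 := tendsto_scaledCauchy (n + 1)
    have h2 := (hcont.tendsto 0).comp (tendsto_inv_atTop_zero (𝕜 := ℝ))
    simpa using (h1.mul h2).mul h1
  refine mem_closure_of_tendsto hF ?_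
  filter_upwards [eventually_gt_atTop 1] with s hs
  have hs0 : 0 < s⁻¹ := inv_pos.2 (by linarith)
  have hG := scaledCauchy_posMinors (n + 1) hs
  have hG' : NonnegMinors (scaledCauchy (n + 1) s) :=
    fun k f g hf hg => (hG k k f g le_rfl hf hg).le
  have hA' := hA.add_single hs0.le
  refine ⟨(hG'.mul hA').mul hG', fun k f g hk hf hg => ?_⟩
  have hkn : k ≤ n + 1 := by simpa using Fintype.card_le_of_injective f hf.injective
  exact det_submatrix_mul_mul_pos hA' hG hG (Fin.strictMono_castLE hkn) (Fin.strictMono_castLE hkn)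
    (hd.add_single hA hs0 hk hkn) hf hg

theorem NonnegMinors.mem_closure_posMinors {n : ℕ} {A : Matrix (Fin (n + 1)) (Fin (n + 1)) ℝ}
    (hA : NonnegMinors A) (d : ℕ) :
    A ∈ closure {B : Matrix (Fin (n + 1)) (Fin (n + 1)) ℝ |
      NonnegMinors B ∧ PosMinorsUpTo d B} := by
  induction d with
  | zero =>
    refine subset_closure ⟨hA, fun k f g hk _ _ => ?_⟩
    obtain rfl : k = 0 := by omega
    simp
  | succ d ih =>
    exact closure_minimal (fun B hB => mem_closure_posMinors_succ hB.1 hB.2) isClosed_closure ih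

/-- The totally positive `m × m` matrices are dense in the totally nonnegative `m × m`
matrices, with respect to the Frobenius norm. -/
theorem stmt_18 (m : ℕ) (hm : 1 ≤ m) (A : Matrix (Fin m) (Fin m) ℝ) (hA : TNN A)
    (ε : ℝ) (hε : 0 < ε) :
    ∃ B : Matrix (Fin m) (Fin m) ℝ, TP B ∧ frob (A - B) < ε := by
  obtain ⟨n, rfl⟩ : ∃ n, m = n + 1 := ⟨m - 1, by omega⟩
  have hcont : Continuous fun B : Matrix (Fin (n + 1)) (Fin (n + 1)) ℝ => frob (A - B) := by
    unfold frob
    simp only [Matrix.sub_apply]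
    fun_prop
  have hopen : IsOpen {B : Matrix (Fin (n + 1)) (Fin (n + 1)) ℝ | frob (A - B) < ε} :=
    isOpen_lt hcont continuous_const
  obtain ⟨B, hBε, hB⟩ := mem_closure_iff.1 (hA.nonnegMinors.mem_closure_posMinors (n + 1)) _ hopen
    (by simpa [frob] using hε)
  exact ⟨B, hB.2.tp, hBε⟩
end

section
/- Let m ≥ 1 be an integer and let d_1,…,d_m, ℓ_1,…,ℓ_m > 0. Let 𝒜 be the 2m×m real matrix whose top m×m block is diag(d_1,…,d_m) and whose (m+i, j) entry equals (−1)^{i+1}·ℓ_i if j = m+1−i and 0 otherwise (i.e., the bottom block is L·W_0 with L = diag(ℓ_1,…,ℓ_m)). Then for every m-element subset I ⊆ {1,…,2m}, the Plücker coordinate Δ_I(𝒜) ≠ 0 if and only if there is no κ ∈ {1,…,m} with both κ ∈ I and 2m+1−κ ∈ I. -/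
open Finset

/-- A square matrix whose `i`-th row has exactly one nonzero entry, in column `f i`, has nonzero
determinant iff `f` is injective. -/
theorem det_ne_zero_iff_injective_of_row_support {n R : Type*} [Fintype n] [DecidableEq n]
    [CommRing R] [IsDomain R] (M : Matrix n n R) (f : n → n)
    (hM : ∀ i j, M i j ≠ 0 ↔ j = f i) : M.det ≠ 0 ↔ Function.Injective f := by
  constructor
  · intro hdet
    rw [Finite.injective_iff_surjective]
    by_contra hf
    obtain ⟨j, hj⟩ := not_forall.mp hf
    refine hdet (Matrix.det_eq_zero_of_column_eq_zero j fun i => ?_)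
    by_contra hij
    exact hj ⟨i, ((hM i j).mp hij).symm⟩
  · intro hf
    let σ : Equiv.Perm n := Equiv.ofBijective f (Finite.injective_iff_bijective.mp hf)
    have hMσ : M = Matrix.of fun i j =>
        M i (f i) * (1 : Matrix n n R).submatrix σ id i j := by
      ext i j
      by_cases h : j = f i
      · simp [σ, h, Matrix.one_apply]
      · have h0 : M i j = 0 := not_not.mp (mt (hM i j).mp h)
        simp [σ, h0, Matrix.one_apply, Ne.symm h]
    rw [hMσ, Matrix.det_mul_column, Matrix.det_permute, Matrix.det_one, mul_one]
    refine mul_ne_zero (Finset.prod_ne_zero_iff.mpr fun i _ => (hM i (f i)).mpr rfl) ?_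
    rcases Int.units_eq_one_or (Equiv.Perm.sign σ) with h | h <;> simp [h]

/-- The column of the nonzero entry in row `i` of the stacked matrix: `i` itself in the top block,
and its reflection `2m - 1 - i` in the bottom block. -/
def foldIndex {m : ℕ} (i : Fin (m + m)) : Fin m :=
  ⟨if (i : ℕ) < m then (i : ℕ) else m + m - 1 - (i : ℕ), by have := i.isLt; split_ifs <;> omega⟩

theorem stack_diagonal_W0_ne_zero_iff {m : ℕ} {d l : Fin m → ℝ} (hd : ∀ i, d i ≠ 0)
    (hl : ∀ i, l i ≠ 0) (i : Fin (m + m)) (j : Fin m) :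
    stack (Matrix.diagonal d) (Matrix.of fun i j : Fin m => l i * W0 m i j) i j ≠ 0 ↔
      j = foldIndex i := by
  have hi := i.isLt
  by_cases h : (i : ℕ) < m
  · simp [stack, h, foldIndex, Matrix.diagonal_apply, Fin.ext_iff, hd, eq_comm]
  · have hij : m - 1 - ((i : ℕ) - m) = m + m - 1 - (i : ℕ) := by omega
    simp [stack, h, foldIndex, W0, Fin.ext_iff, hl, hij]

theorem injOn_foldIndex_iff {m : ℕ} (I : Finset (Fin (m + m))) :
    Set.InjOn foldIndex (I : Set (Fin (m + m))) ↔
      ∀ κ : Fin (m + m), (κ : ℕ) < m →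
        ¬(κ ∈ I ∧ (⟨m + m - 1 - (κ : ℕ), by omega⟩ : Fin (m + m)) ∈ I) := by
  constructor
  · rintro hinj κ hκ ⟨h₁, h₂⟩
    have h := hinj h₁ h₂ (by
      simp only [foldIndex, Fin.mk.injEq]
      split_ifs <;> omega)
    simp only [Fin.ext_iff] at h
    omega
  · intro hI a ha b hb hab
    have hreflect : ∀ x y : Fin (m + m), x ∈ I → y ∈ I → (x : ℕ) < m → ¬ (y : ℕ) < m →
        (x : ℕ) ≠ m + m - 1 - (y : ℕ) := by
      intro x y hx hy hxm hym hxy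
      refine hI x hxm ⟨hx, ?_⟩
      convert hy using 1
      ext
      simp only
      omega
    have hab' := hreflect a b ha hb
    have hba' := hreflect b a hb ha
    simp only [foldIndex, Fin.mk.injEq] at hab
    ext
    split_ifs at hab <;> omega

/-- For the `2m × m` matrix stacking `diag(d₁,…,d_m)` on top of `L·W₀` (`L = diag(ℓ₁,…,ℓ_m)`),
the Plücker coordinate `Δ_I ≠ 0` iff there is no `κ ∈ {1,…,m}` with both `κ ∈ I` and
`2m+1-κ ∈ I`. -/
theorem stmt_19 (m : ℕ) (hm : 1 ≤ m) (d l : Fin m → ℝ)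
    (hd : ∀ i, 0 < d i) (hl : ∀ i, 0 < l i)
    (I : Finset (Fin (m + m))) (hI : I.card = m) :
    pluck (stack (Matrix.diagonal d)
        (Matrix.of fun i j : Fin m => l i * W0 m i j)) I ≠ 0 ↔
      ∀ κ : Fin (m + m), (κ : ℕ) < m →
        ¬(κ ∈ I ∧ (⟨m + m - 1 - (κ : ℕ), by omega⟩ : Fin (m + m)) ∈ I) := by
  rw [pluck, dif_pos hI]
  refine (det_ne_zero_iff_injective_of_row_support _
    (fun k => foldIndex (I.orderIsoOfFin hI k : Fin (m + m))) fun i j =>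
    stack_diagonal_W0_ne_zero_iff (fun i => (hd i).ne') (fun i => (hl i).ne') _ j).trans ?_
  rw [← injOn_foldIndex_iff, Set.injOn_iff_injective]
  exact (I.orderIsoOfFin hI).toEquiv.injective_comp
    ((I : Set (Fin (m + m))).domRestrict foldIndex)
end
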